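/- (Hiai–Petz logarithmic trace inequality, as implied by the BLP inequality.) Let A and B be n×n complex positive definite matrices. Then for every real p > 0: Tr[A · (log A + log B)] ≤ (1/p) · Tr[A · log(A^{p/2} B^p A^{p/2})]. -/

import Mathlib

open scoped ComplexOrder

/-- `mpow A s` is the matrix power `A ^ s` (for real `s`) defined via the continuous
functional calculus: if `A = Σ_i λ_i P_i` is a spectral decomposition, `mpow A s = Σ_i λ_i ^ s • P_i`. -/
noncomputable def mpow {m : ℕ} (A : Matrix (Fin m) (Fin m) ℂ) (s : ℝ) :
    Matrix (Fin m) (Fin m) ℂ :=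
  cfc (fun x : ℝ => x ^ s) A

/-- `mfun f A` is `f(A)` defined via the continuous functional calculus:
if `A = Σ_i λ_i P_i` is a spectral decomposition, `mfun f A = Σ_i f (λ_i) • P_i`. -/
noncomputable def mfun {m : ℕ} (f : ℝ → ℝ) (A : Matrix (Fin m) (Fin m) ℂ) :
    Matrix (Fin m) (Fin m) ℂ :=
  cfc f A

/-- `mlog A` is the matrix logarithm `log A` defined via the continuous functional calculus. -/
noncomputable def mlog {m : ℕ} (A : Matrix (Fin m) (Fin m) ℂ) : Matrix (Fin m) (Fin m) ℂ :=
  mfun Real.log A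


namespace HP
open Matrix

lemma spec {n : ℕ} {M : Matrix (Fin n) (Fin n) ℂ} (hM : M.PosDef) :
    ∃ (U : Matrix (Fin n) (Fin n) ℂ) (l : Fin n → ℝ), Uᴴ * U = 1 ∧ U * Uᴴ = 1 ∧ (∀ i, 0 < l i) ∧
      ∀ f : ℝ → ℝ, cfc f M = U * diagonal (fun i => ((f (l i) : ℝ) : ℂ)) * Uᴴ := by
  refine ⟨hM.1.eigenvectorUnitary, hM.1.eigenvalues, ?_, ?_, fun i => hM.eigenvalues_pos i, ?_⟩
  · exact Unitary.coe_star_mul_self hM.1.eigenvectorUnitary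
  · exact Unitary.coe_mul_star_self hM.1.eigenvectorUnitary
  · intro f
    rw [hM.1.cfc_eq f, Matrix.IsHermitian.cfc, Unitary.conjStarAlgAut_apply]
    rfl

lemma tr_spec {n : ℕ} (A U : Matrix (Fin n) (Fin n) ℂ) (d : Fin n → ℝ) :
    (trace (A * (U * diagonal (fun i => ((d i : ℝ) : ℂ)) * Uᴴ))).re
      = ∑ i, ((Uᴴ * A * U) i i).re * d i := by
  have : trace (A * (U * diagonal (fun i => ((d i : ℝ) : ℂ)) * Uᴴ))
      = trace ((Uᴴ * A * U) * diagonal (fun i => ((d i : ℝ) : ℂ))) := by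
    rw [← Matrix.mul_assoc, Matrix.trace_mul_comm]
    simp only [Matrix.mul_assoc]
  rw [this]
  simp [trace, Matrix.mul_diagonal]

lemma tr_rep {n : ℕ} {M : Matrix (Fin n) (Fin n) ℂ} (hM : M.PosDef) :
    ∃ l : Fin n → ℝ, (∀ i, 0 < l i) ∧ ∀ A : Matrix (Fin n) (Fin n) ℂ, ∃ α : Fin n → ℝ,
      ∀ f : ℝ → ℝ, (trace (A * cfc f M)).re = ∑ i, α i * f (l i) := by
  obtain ⟨U, l, h1, h2, h3, h4⟩ := spec hM
  refine ⟨l, h3, fun A => ⟨fun i => ((Uᴴ * A * U) i i).re, fun f => ?_⟩⟩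
  rw [h4, tr_spec A U (fun i => f (l i))]

lemma cfc_ext {n : ℕ} {M : Matrix (Fin n) (Fin n) ℂ} (hM : M.PosDef) {f g : ℝ → ℝ}
    (h : ∀ x, 0 < x → f x = g x) : cfc f M = cfc g M := by
  obtain ⟨U, l, h1, h2, h3, h4⟩ := spec hM
  rw [h4, h4]
  simp only [h _ (h3 _)]

lemma cfc_mm {n : ℕ} {M : Matrix (Fin n) (Fin n) ℂ} (hM : M.PosDef) (f g : ℝ → ℝ) :
    cfc f M * cfc g M = cfc (fun x => f x * g x) M := by
  obtain ⟨U, l, h1, h2, h3, h4⟩ := spec hM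
  rw [h4, h4, h4]
  calc _ = U * diagonal (fun i => ((f (l i) : ℝ) : ℂ)) * (Uᴴ * U)
          * diagonal (fun i => ((g (l i) : ℝ) : ℂ)) * Uᴴ := by simp only [Matrix.mul_assoc]
    _ = _ := by
      rw [h1, Matrix.mul_one, Matrix.mul_assoc U, diagonal_mul_diagonal]
      simp

lemma cfc_ss {n : ℕ} {M : Matrix (Fin n) (Fin n) ℂ} (hM : M.PosDef) (f g : ℝ → ℝ) :
    cfc f M - cfc g M = cfc (fun x => f x - g x) M := by
  obtain ⟨U, l, h1, h2, h3, h4⟩ := spec hM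
  rw [h4, h4, h4, ← Matrix.sub_mul, ← Matrix.mul_sub, diagonal_sub]
  simp

lemma cfc_aa {n : ℕ} {M : Matrix (Fin n) (Fin n) ℂ} (hM : M.PosDef) (f g : ℝ → ℝ) :
    cfc f M + cfc g M = cfc (fun x => f x + g x) M := by
  obtain ⟨U, l, h1, h2, h3, h4⟩ := spec hM
  rw [h4, h4, h4, ← Matrix.add_mul, ← Matrix.mul_add, diagonal_add]
  simp

lemma cfc_cc {n : ℕ} {M : Matrix (Fin n) (Fin n) ℂ} (hM : M.PosDef) (c : ℝ) :
    cfc (fun _ => c) M = (c : ℂ) • (1 : Matrix (Fin n) (Fin n) ℂ) := by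
  obtain ⟨U, l, h1, h2, h3, h4⟩ := spec hM
  rw [h4, ← smul_one_eq_diagonal, mul_smul_one, smul_mul_assoc, h2]

lemma cfc_ii {n : ℕ} {M : Matrix (Fin n) (Fin n) ℂ} (hM : M.PosDef) :
    cfc (fun x : ℝ => x) M = M := cfc_id' ℝ M hM.1.isSelfAdjoint

lemma cfc_psd {n : ℕ} {M : Matrix (Fin n) (Fin n) ℂ} (hM : M.PosDef) {f : ℝ → ℝ}
    (h : ∀ x, 0 < x → 0 ≤ f x) : (cfc f M).PosSemidef := by
  obtain ⟨U, l, h1, h2, h3, h4⟩ := spec hM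
  rw [h4]
  apply PosSemidef.mul_mul_conjTranspose_same
  apply PosSemidef.diagonal
  intro i
  simpa using h _ (h3 i)

lemma cfc_pd {n : ℕ} {M : Matrix (Fin n) (Fin n) ℂ} (hM : M.PosDef) {f : ℝ → ℝ}
    (h : ∀ x, 0 < x → 0 < f x) : (cfc f M).PosDef := by
  rw [(cfc_psd hM (fun x hx => (h x hx).le)).posDef_iff_isUnit]
  apply IsUnit.of_mul_eq_one (cfc (fun x => (f x)⁻¹) M)
  rw [cfc_mm hM, cfc_ext hM (g := fun _ => 1), cfc_cc hM]
  · simp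
  · intro x hx
    exact mul_inv_cancel₀ (h x hx).ne'

lemma cfc_hh {n : ℕ} (M : Matrix (Fin n) (Fin n) ℂ) (f : ℝ → ℝ) : (cfc f M)ᴴ = cfc f M :=
  cfc_predicate f M

lemma conj_pd {n : ℕ} {M C D : Matrix (Fin n) (Fin n) ℂ} (hM : M.PosDef) (hC : Cᴴ = C)
    (hD : C * D = 1) : (C * M * C).PosDef := by
  have h := (IsUnit.of_mul_eq_one D hD).posDef_star_right_conjugate_iff (x := M)
  rw [star_eq_conjTranspose, hC] at h
  exact h.2 hM

lemma tr_nonneg {n : ℕ} {A M : Matrix (Fin n) (Fin n) ℂ} (hA : A.PosDef) (hM : M.PosSemidef) :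
    0 ≤ (trace (A * M)).re := by
  have h1 : A = cfc Real.sqrt A * cfc Real.sqrt A := by
    rw [cfc_mm hA, cfc_ext hA (g := fun x => x), cfc_ii hA]
    intro x hx
    exact Real.mul_self_sqrt hx.le
  have h2 : trace (A * M) = trace (cfc Real.sqrt A * M * (cfc Real.sqrt A)ᴴ) := by
    rw [cfc_hh]
    conv_lhs => rw [h1]
    rw [Matrix.mul_assoc, Matrix.trace_mul_comm]
  rw [h2]
  exact (Complex.le_def.1 (hM.mul_mul_conjTranspose_same _).trace_nonneg).1

/-- comonotone commutators -/
lemma comon {n : ℕ} {A : Matrix (Fin n) (Fin n) ℂ} (hA : A.PosDef) (f g : ℝ → ℝ)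
    (hfg : ∀ x y, 0 < x → 0 < y → 0 ≤ (f x - f y) * (g x - g y))
    {Q : Matrix (Fin n) (Fin n) ℂ} (hQ : Qᴴ = Q) :
    (trace ((Q * cfc f A - cfc f A * Q) * (Q * cfc g A - cfc g A * Q))).re ≤ 0 := by
  obtain ⟨U, l, h1, h2, h3, h4⟩ := spec hA
  set P := Uᴴ * Q * U with hP
  have hPP : Pᴴ = P := by
    simp [hP, Matrix.conjTranspose_mul, hQ, Matrix.mul_assoc]
  have key : ∀ f : ℝ → ℝ, Q * cfc f A - cfc f A * Q
      = U * (P * diagonal (fun i => ((f (l i) : ℝ) : ℂ))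
          - diagonal (fun i => ((f (l i) : ℝ) : ℂ)) * P) * Uᴴ := by
    intro f
    rw [h4, hP, Matrix.mul_sub, Matrix.sub_mul]
    congr 1
    · calc _ = 1 * Q * U * diagonal (fun i => ((f (l i) : ℝ) : ℂ)) * Uᴴ := by
            simp only [Matrix.mul_assoc, Matrix.one_mul]
        _ = _ := by rw [← h2]; simp only [Matrix.mul_assoc]
    · calc _ = U * diagonal (fun i => ((f (l i) : ℝ) : ℂ)) * Uᴴ * Q * 1 := by
            simp only [Matrix.mul_one]
        _ = _ := by rw [← h2]; simp only [Matrix.mul_assoc]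
  rw [key f, key g]
  generalize hX : (P * diagonal (fun i => ((f (l i) : ℝ) : ℂ))
          - diagonal (fun i => ((f (l i) : ℝ) : ℂ)) * P) = X
  generalize hY : (P * diagonal (fun i => ((g (l i) : ℝ) : ℂ))
          - diagonal (fun i => ((g (l i) : ℝ) : ℂ)) * P) = Y
  have e : trace (U * X * Uᴴ * (U * Y * Uᴴ)) = trace (X * Y) := by
    calc _ = trace (U * (X * (Uᴴ * U) * Y * Uᴴ)) := by simp only [Matrix.mul_assoc]
      _ = trace (X * Y * (Uᴴ * U)) := by
        rw [h1, Matrix.mul_one, Matrix.trace_mul_comm, Matrix.mul_assoc, h1]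
      _ = _ := by rw [h1, Matrix.mul_one]
  rw [e]
  simp only [trace, diag_apply, Matrix.mul_apply, Complex.re_sum]
  apply Finset.sum_nonpos
  intro i _
  apply Finset.sum_nonpos
  intro j _
  have hx : X i j = P i j * ((f (l j) - f (l i) : ℝ) : ℂ) := by
    rw [← hX]
    simp [Matrix.mul_diagonal, Matrix.diagonal_mul]
    ring
  have hy : Y j i = (starRingEnd ℂ) (P i j) * ((g (l i) - g (l j) : ℝ) : ℂ) := by
    have : P j i = (starRingEnd ℂ) (P i j) := by
      conv_lhs => rw [← hPP]
      rfl
    rw [← hY, ← this]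
    simp [Matrix.mul_diagonal, Matrix.diagonal_mul]
    ring
  have hz : X i j * Y j i
      = ((-(Complex.normSq (P i j) * ((f (l i) - f (l j)) * (g (l i) - g (l j)))) : ℝ) : ℂ) := by
    rw [hx, hy]
    push_cast
    rw [← Complex.mul_conj]
    ring
  rw [hz, Complex.ofReal_re]
  have := mul_nonneg (Complex.normSq_nonneg (P i j)) (hfg _ _ (h3 i) (h3 j))
  linarith

lemma pointwise {n : ℕ} {A W Z D : Matrix (Fin n) (Fin n) ℂ} (hA : A.PosDef) (hW : W.PosDef)
    (hZ : Z.PosDef) (g : ℝ → ℝ) (hD : D = cfc g A)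
    (hg : ∀ x y, 0 < x → 0 < y → 0 ≤ (x - y) * (g x - g y))
    (hWZ : Z = (1 - D) * W * (1 - D)) {w δ : ℝ} (hw0 : 0 ≤ w)
    (hw : ((w : ℂ) • (1 : Matrix (Fin n) (Fin n) ℂ) - W).PosSemidef)
    (hδ : ((δ : ℂ) • (1 : Matrix (Fin n) (Fin n) ℂ) - D * D).PosSemidef) {s : ℝ} (hs : 0 ≤ s) :
    0 ≤ (trace (A * cfc (fun x => (x + s)⁻¹) Z)).re - (trace (A * cfc (fun x => (x + s)⁻¹) W)).re
      - 2 * (trace (A * D * cfc (fun x => x * ((x + s)⁻¹ * (x + s)⁻¹)) W)).re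
      + w * δ * (trace (A * cfc (fun x => (x + s)⁻¹ * (x + s)⁻¹) W)).re := by
  have inv : ∀ {M : Matrix (Fin n) (Fin n) ℂ}, M.PosDef →
      cfc (fun x => (x + s)⁻¹) M * M = 1 - (s : ℂ) • cfc (fun x => (x + s)⁻¹) M ∧
      M * cfc (fun x => (x + s)⁻¹) M = 1 - (s : ℂ) • cfc (fun x => (x + s)⁻¹) M := by
    intro M hM
    have h1 : (s : ℂ) • cfc (fun x => (x + s)⁻¹) M = cfc (fun x => s * (x + s)⁻¹) M := by
      rw [← cfc_mm hM, cfc_cc hM, smul_mul_assoc, Matrix.one_mul]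
    have h2 : (1 : Matrix (Fin n) (Fin n) ℂ) = cfc (fun _ => (1 : ℝ)) M := by
      rw [cfc_cc hM]; simp
    have h3 : M = cfc (fun x : ℝ => x) M := (cfc_ii hM).symm
    constructor
    · rw [h1, h2, cfc_ss hM]
      calc _ = cfc (fun x => (x + s)⁻¹) M * cfc (fun x : ℝ => x) M := by rw [cfc_ii hM]
        _ = _ := by
          rw [cfc_mm hM]
          apply cfc_ext hM
          intro x hx
          have : x + s ≠ 0 := by positivity
          field_simp
          ring
    · rw [h1, h2, cfc_ss hM]
      calc _ = cfc (fun x : ℝ => x) M * cfc (fun x => (x + s)⁻¹) M := by rw [cfc_ii hM]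
        _ = _ := by
          rw [cfc_mm hM]
          apply cfc_ext hM
          intro x hx
          have : x + s ≠ 0 := by positivity
          field_simp
          ring
  have hDh : Dᴴ = D := by rw [hD, cfc_hh]
  have hAD : D * A = A * D := by
    have : A = cfc (fun x : ℝ => x) A := (cfc_ii hA).symm
    rw [hD]
    calc _ = cfc g A * cfc (fun x : ℝ => x) A := by rw [cfc_ii hA]
      _ = cfc (fun x : ℝ => x) A * cfc g A := by
        rw [cfc_mm hA, cfc_mm hA]; simp only [mul_comm]
      _ = _ := by rw [cfc_ii hA]
  have eRR : cfc (fun x => (x + s)⁻¹ * (x + s)⁻¹) W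
      = cfc (fun x => (x + s)⁻¹) W * cfc (fun x => (x + s)⁻¹) W := (cfc_mm hW _ _).symm
  have eWRR : cfc (fun x => x * ((x + s)⁻¹ * (x + s)⁻¹)) W
      = W * (cfc (fun x => (x + s)⁻¹) W * cfc (fun x => (x + s)⁻¹) W) := by
    rw [← eRR]
    calc _ = cfc (fun x : ℝ => x) W * cfc (fun x => (x + s)⁻¹ * (x + s)⁻¹) W := by
          rw [cfc_mm hW]
      _ = _ := by rw [cfc_ii hW]
  rw [eRR, eWRR]
  have hcom := comon hA (fun x => x) g hg (cfc_hh W (fun x => (x + s)⁻¹))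
  rw [cfc_ii hA, ← hD] at hcom
  have hSp : (cfc (fun x => (x + s)⁻¹) Z).PosSemidef :=
    cfc_psd hZ (fun x hx => by positivity)
  obtain ⟨rw1, rw2⟩ := inv hW
  obtain ⟨sz1, sz2⟩ := inv hZ
  have hRh := cfc_hh W (fun x => (x + s)⁻¹)
  generalize cfc (fun x => (x + s)⁻¹) W = R at *
  generalize cfc (fun x => (x + s)⁻¹) Z = S at *
  set E := W - Z with hE
  have hEh : Eᴴ = E := by
    rw [hE, Matrix.conjTranspose_sub, hW.1.eq, hZ.1.eq]
  have k1 : S - R = S * E * R := by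
    rw [hE, Matrix.mul_sub, Matrix.sub_mul, sz1, Matrix.mul_assoc, rw2]
    simp [Matrix.mul_sub, Matrix.sub_mul]
  have k2 : S - R = R * E * S := by
    rw [hE, Matrix.mul_sub, Matrix.sub_mul, rw1, Matrix.mul_assoc, sz2]
    simp [Matrix.mul_sub, Matrix.sub_mul]
  have I1 : 0 ≤ (trace (A * (S - R - R * E * R))).re := by
    have : S - R - R * E * R = (R * E) * S * (R * E)ᴴ := by
      rw [Matrix.conjTranspose_mul, hRh, hEh]
      calc _ = S * E * R - R * E * R := by rw [k1]
        _ = (S - R) * E * R := by rw [Matrix.sub_mul, Matrix.sub_mul]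
        _ = _ := by rw [k2]; simp only [Matrix.mul_assoc]
    rw [this]
    exact tr_nonneg hA (hSp.mul_mul_conjTranspose_same _)
  have I3 : 0 ≤ (trace (A * ((R * D) * ((w : ℂ) • 1 - W) * (R * D)ᴴ))).re :=
    tr_nonneg hA (hw.mul_mul_conjTranspose_same _)
  have I4 : 0 ≤ (trace (A * (R * ((δ : ℂ) • 1 - D * D) * Rᴴ))).re :=
    tr_nonneg hA (hδ.mul_mul_conjTranspose_same _)
  rw [Matrix.conjTranspose_mul, hRh, hDh] at I3
  rw [hRh] at I4
  have eE : R * E * R = R * D + D * R - (2 * s : ℂ) • (R * D * R) - R * D * W * D * R := by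
    have : E = D * W + W * D - D * W * D := by rw [hE, hWZ]; noncomm_ring
    calc R * E * R = R * D * (W * R) + (R * W) * D * R - R * D * W * D * R := by
          rw [this]; noncomm_ring
      _ = _ := by
        rw [rw1, rw2]
        simp only [Matrix.mul_sub, Matrix.sub_mul, Matrix.mul_one, Matrix.one_mul,
          Matrix.mul_smul, Matrix.smul_mul, two_mul, add_smul]
        abel
  rw [eE] at I1
  have t1 : trace (A * (D * R)) = trace (A * (R * D)) := by
    rw [← Matrix.mul_assoc, ← hAD, Matrix.mul_assoc, Matrix.trace_mul_comm, Matrix.mul_assoc]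
  have t2 : trace ((R * A - A * R) * (R * D - D * R))
      = 2 * trace (A * (R * D * R)) - 2 * trace (A * (D * (R * R))) := by
    have a1 : trace (R * (A * (R * D))) = trace (A * (R * (D * R))) := by
      rw [Matrix.trace_mul_comm]; simp only [Matrix.mul_assoc]
    have a2 : trace (R * (A * (D * R))) = trace (A * (D * (R * R))) := by
      rw [Matrix.trace_mul_comm]; simp only [Matrix.mul_assoc]
    have a3 : trace (A * (R * (R * D))) = trace (A * (D * (R * R))) := by
      rw [← Matrix.mul_assoc A D, ← hAD, Matrix.mul_assoc D, Matrix.trace_mul_comm D]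
      simp only [Matrix.mul_assoc]
    simp only [Matrix.mul_sub, Matrix.sub_mul, Matrix.trace_sub, Matrix.mul_assoc, a1, a2, a3]
    ring
  rw [t2] at hcom
  have t3 : W * (R * R) = R - (s : ℂ) • (R * R) := by
    rw [← Matrix.mul_assoc, rw2]
    simp [Matrix.sub_mul]
  rw [t3]
  simp only [Matrix.mul_sub, Matrix.mul_add, Matrix.sub_mul, Matrix.mul_smul, Matrix.smul_mul,
    Matrix.mul_one, Matrix.trace_sub, Matrix.trace_add, Matrix.trace_smul, smul_eq_mul,
    Matrix.mul_assoc, Complex.sub_re, Complex.add_re, Complex.re_ofReal_mul, t1,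
    mul_assoc,
    show (2 :ℂ) = ((2 : ℝ) : ℂ) by push_cast; rfl] at *
  nlinarith [mul_nonneg hw0 I4, mul_nonneg hs (neg_nonneg.2 hcom)]

lemma scalar {n : ℕ} (l m α β γ : Fin n → ℝ) (k : ℝ) (hl : ∀ i, 0 < l i) (hm : ∀ i, 0 < m i)
    (hab : ∑ i, α i = ∑ i, β i)
    (h : ∀ s : ℝ, 0 ≤ s → 0 ≤ ∑ i, α i * (m i + s)⁻¹ - ∑ i, β i * (l i + s)⁻¹
      - 2 * ∑ i, γ i * (l i * ((l i + s)⁻¹ * (l i + s)⁻¹))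
      + k * ∑ i, β i * ((l i + s)⁻¹ * (l i + s)⁻¹)) :
    ∑ i, α i * Real.log (m i) - ∑ i, β i * Real.log (l i) + 2 * ∑ i, γ i
      - k * ∑ i, β i * (l i)⁻¹ ≤ 0 := by
  let Φ : ℝ → ℝ := fun s => ∑ i, α i * Real.log (s + m i) - ∑ i, β i * Real.log (s + l i)
      + 2 * ∑ i, γ i * (l i * (s + l i)⁻¹) - k * ∑ i, β i * (s + l i)⁻¹
  have hd : ∀ s : ℝ, 0 ≤ s → HasDerivAt Φ (∑ i, α i * (m i + s)⁻¹ - ∑ i, β i * (l i + s)⁻¹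
      - 2 * ∑ i, γ i * (l i * ((l i + s)⁻¹ * (l i + s)⁻¹))
      + k * ∑ i, β i * ((l i + s)⁻¹ * (l i + s)⁻¹)) s := by
    intro s hs
    have d1 : ∀ c : ℝ, 0 < c → HasDerivAt (fun s => Real.log (s + c)) ((c + s)⁻¹) s := by
      intro c hc
      have : s + c ≠ 0 := by positivity
      have := ((hasDerivAt_id s).add_const c).log this
      simpa [add_comm] using this
    have d2 : ∀ c : ℝ, 0 < c →
        HasDerivAt (fun s => (s + c)⁻¹) (-((c + s)⁻¹ * (c + s)⁻¹)) s := by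
      intro c hc
      have hne : s + c ≠ 0 := by positivity
      have := ((hasDerivAt_id s).add_const c).inv hne
      refine this.congr_deriv ?_
      simp only [id, add_comm c s]
      field_simp
    have e1 := HasDerivAt.fun_sum (u := Finset.univ) (fun i _ => (d1 (m i) (hm i)).const_mul (α i))
    have e2 := HasDerivAt.fun_sum (u := Finset.univ) (fun i _ => (d1 (l i) (hl i)).const_mul (β i))
    have e3 := HasDerivAt.fun_sum (u := Finset.univ)
      (fun i _ => ((d2 (l i) (hl i)).const_mul (l i)).const_mul (γ i))
    have e4 := HasDerivAt.fun_sum (u := Finset.univ) (fun i _ => (d2 (l i) (hl i)).const_mul (β i))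
    refine (((e1.sub e2).add (e3.const_mul 2)).sub (e4.const_mul k)).congr_deriv ?_
    simp only [mul_neg, Finset.sum_neg_distrib]
    ring
  have hmono : MonotoneOn Φ (Set.Ici 0) := by
    refine monotoneOn_of_hasDerivWithinAt_nonneg (convex_Ici 0)
      (fun s hs => (hd s hs).continuousAt.continuousWithinAt)
      (fun s hs => (hd s ?_).hasDerivWithinAt) (fun s hs => h s ?_)
    · exact interior_subset hs
    · exact interior_subset hs
  have hlim : Filter.Tendsto Φ Filter.atTop (nhds 0) := by
    have l1 : ∀ c : ℝ, Filter.Tendsto (fun s => Real.log (s + c) - Real.log s) Filter.atTop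
        (nhds 0) := fun c => Real.tendsto_log_comp_add_sub_log c
    have l2 : ∀ c : ℝ, Filter.Tendsto (fun s : ℝ => (s + c)⁻¹) Filter.atTop (nhds 0) := fun c =>
      tendsto_inv_atTop_zero.comp (Filter.tendsto_atTop_add_const_right _ c Filter.tendsto_id)
    have e1 := tendsto_finsetSum (Finset.univ) (fun i _ => (l1 (m i)).const_mul (α i))
    have e2 := tendsto_finsetSum (Finset.univ) (fun i _ => (l1 (l i)).const_mul (β i))
    have e3 := tendsto_finsetSum (Finset.univ)
      (fun i _ => ((l2 (l i)).const_mul (l i)).const_mul (γ i))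
    have e4 := tendsto_finsetSum (Finset.univ) (fun i _ => (l2 (l i)).const_mul (β i))
    have e := ((e1.sub e2).add (e3.const_mul 2)).sub (e4.const_mul k)
    simp only [mul_zero, Finset.sum_const_zero, sub_zero, add_zero] at e
    refine e.congr ?_
    intro s
    simp only [Φ, mul_sub, Finset.sum_sub_distrib, ← Finset.sum_mul, hab]
    ring
  have h0 : Φ 0 ≤ 0 := by
    refine ge_of_tendsto hlim ?_
    filter_upwards [Filter.eventually_ge_atTop 0] with s hs
    exact hmono (Set.mem_Ici.2 le_rfl) hs hs
  have : ∀ i, l i * (l i)⁻¹ = 1 := fun i => mul_inv_cancel₀ (hl i).ne'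
  simpa [Φ, this] using h0

lemma core {n : ℕ} {A W Z D : Matrix (Fin n) (Fin n) ℂ} (hA : A.PosDef) (hW : W.PosDef)
    (hZ : Z.PosDef) (g : ℝ → ℝ) (hD : D = cfc g A)
    (hg : ∀ x y, 0 < x → 0 < y → 0 ≤ (x - y) * (g x - g y))
    (hWZ : Z = (1 - D) * W * (1 - D)) {w δ : ℝ} (hw0 : 0 ≤ w)
    (hw : ((w : ℂ) • (1 : Matrix (Fin n) (Fin n) ℂ) - W).PosSemidef)
    (hδ : ((δ : ℂ) • (1 : Matrix (Fin n) (Fin n) ℂ) - D * D).PosSemidef) :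
    2 * (trace (A * D)).re - w * δ * (trace (A * cfc (fun x : ℝ => x⁻¹) W)).re ≤
    (trace (A * cfc Real.log W)).re - (trace (A * cfc Real.log Z)).re := by
  obtain ⟨l, hl, hl'⟩ := tr_rep hW
  obtain ⟨m, hm, hm'⟩ := tr_rep hZ
  obtain ⟨α, hα⟩ := hm' A
  obtain ⟨β, hβ⟩ := hl' A
  obtain ⟨γ, hγ⟩ := hl' (A * D)
  have c1 := hα (fun _ => 1)
  have c2 := hβ (fun _ => 1)
  have c3 := hγ (fun _ => 1)
  rw [cfc_cc hZ] at c1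
  rw [cfc_cc hW] at c2 c3
  simp only [Complex.ofReal_one, one_smul, Matrix.mul_one, mul_one] at c1 c2 c3
  have := scalar l m α β γ (w * δ) hl hm (by rw [← c1, ← c2]) (by
    intro s hs
    have := pointwise hA hW hZ g hD hg hWZ hw0 hw hδ hs
    rw [hα, hβ, hγ, hβ] at this
    exact this)
  rw [hα, hβ, hβ, c3]
  linarith

lemma subdiv (G : ℝ → ℝ) (C η p : ℝ) (hη : 0 < η) (hp : 0 < p)
    (h : ∀ x y, 0 ≤ x → x ≤ y → y ≤ p → y - x ≤ η → -(C * (y - x) ^ 2) ≤ G y - G x) :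
    G 0 ≤ G p := by
  have key : ∀ N : ℕ, p / η ≤ N → 0 < N → -(C * p ^ 2) / N ≤ G p - G 0 := by
    intro N hN hN0
    have hN' : (0 : ℝ) < N := by exact_mod_cast hN0
    have h1 : G p - G 0 = ∑ i ∈ Finset.range N, (G (p / N * ((i + 1 : ℕ) : ℝ)) - G (p / N * (i : ℝ))) := by
      rw [Finset.sum_range_sub (fun i : ℕ => G (p / N * (i : ℝ)))]
      simp only [Nat.cast_zero, mul_zero]
      rw [div_mul_cancel₀ _ hN'.ne']
    rw [h1]
    have h2 : ∀ i ∈ Finset.range N, -(C * (p / N) ^ 2)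
        ≤ G (p / N * ((i + 1 : ℕ) : ℝ)) - G (p / N * (i : ℝ)) := by
      intro i hi
      have hi' : ((i + 1 : ℕ) : ℝ) ≤ N := by
        exact_mod_cast (Finset.mem_range.1 hi)
      have e : p / N * ((i + 1 : ℕ) : ℝ) - p / N * (i : ℝ) = p / N := by push_cast; ring
      have := h (p / N * (i : ℝ)) (p / N * ((i + 1 : ℕ) : ℝ)) (by positivity)
        (by have : 0 < p / N := by positivity
            linarith)
        (by calc _ ≤ p / N * N := by gcongr
              _ = p := div_mul_cancel₀ _ hN'.ne')
        (by rw [e, div_le_iff₀ hN']; rw [div_le_iff₀ hη] at hN; linarith)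
      rwa [e] at this
    have h3 := Finset.card_nsmul_le_sum _ _ _ h2
    simp only [Finset.card_range, nsmul_eq_mul] at h3
    refine le_trans (le_of_eq ?_) h3
    field_simp
  have hl : Filter.Tendsto (fun N : ℕ => -(C * p ^ 2) / (N : ℝ)) Filter.atTop (nhds 0) :=
    tendsto_const_div_atTop_nhds_zero_nat _
  have : 0 ≤ G p - G 0 := by
    refine le_of_tendsto hl ?_
    filter_upwards [Filter.eventually_ge_atTop ⌈p / η⌉₊, Filter.eventually_gt_atTop 0] with N h1 h2
    exact key N (Nat.ceil_le.1 h1) h2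
  linarith

lemma psd_log {n : ℕ} {A : Matrix (Fin n) (Fin n) ℂ} (hA : A.PosDef) :
    ∃ L : ℝ, 0 < L ∧ ∀ f : ℝ → ℝ, (∀ x, 0 < x → |Real.log x| ≤ L → 0 ≤ f x) →
      (cfc f A).PosSemidef := by
  obtain ⟨U, l, h1, h2, h3, h4⟩ := spec hA
  refine ⟨∑ i, |Real.log (l i)| + 1, by positivity, fun f h => ?_⟩
  rw [h4]
  apply PosSemidef.mul_mul_conjTranspose_same
  apply PosSemidef.diagonal
  intro i
  have := Finset.single_le_sum (f := fun i => |Real.log (l i)|) (fun i _ => abs_nonneg _)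
    (Finset.mem_univ i)
  simpa using h _ (h3 i) (by linarith)

lemma psd_tr {n : ℕ} {M : Matrix (Fin n) (Fin n) ℂ} (hM : M.PosDef) {r : ℝ}
    (hr : (trace M).re ≤ r) :
    ((r : ℂ) • (1 : Matrix (Fin n) (Fin n) ℂ) - M).PosSemidef := by
  obtain ⟨U, l, h1, h2, h3, h4⟩ := spec hM
  have ht : (trace M).re = ∑ i, l i := by
    have := tr_spec 1 U l
    rw [← h4 (fun x => x), cfc_ii hM, Matrix.one_mul, Matrix.mul_one, h1] at this
    simpa using this
  have : (r : ℂ) • (1 : Matrix (Fin n) (Fin n) ℂ) - M = cfc (fun x => r - x) M := by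
    rw [← cfc_ss hM, cfc_cc hM, cfc_ii hM]
  rw [this, h4]
  apply PosSemidef.mul_mul_conjTranspose_same
  apply PosSemidef.diagonal
  intro i
  have := Finset.single_le_sum (f := l) (fun i _ => (h3 i).le) (Finset.mem_univ i)
  have h : 0 ≤ r - l i := by linarith
  have := Complex.zero_le_real.2 h
  simpa using this

lemma bdd {n : ℕ} {A : Matrix (Fin n) (Fin n) ℂ} (hA : A.PosDef)
    (Y : Matrix (Fin n) (Fin n) ℂ) (e : ℝ → ℝ) (he : Continuous e) (p : ℝ) :
    ∃ c : ℝ, 0 ≤ c ∧ ∀ t, 0 ≤ t → t ≤ p → (trace (Y * cfc (fun x : ℝ => x ^ (e t)) A)).re ≤ c := by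
  obtain ⟨l, hl, hl'⟩ := tr_rep hA
  obtain ⟨α, hα⟩ := hl' Y
  have hc : Continuous (fun t => (trace (Y * cfc (fun x : ℝ => x ^ (e t)) A)).re) := by
    simp only [hα]
    refine continuous_finsetSum _ (fun i _ => continuous_const.mul ?_)
    exact continuous_const.rpow he (fun t => Or.inl (hl i).ne')
  obtain ⟨c, hc⟩ := (isCompact_Icc (a := (0 : ℝ)) (b := p)).exists_bound_of_continuousOn hc.continuousOn
  refine ⟨|c|, abs_nonneg _, fun t h0 h1 => ?_⟩
  exact (le_abs_self _).trans ((hc t ⟨h0, h1⟩).trans (le_abs_self c))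

lemma pow_mm {n : ℕ} {A : Matrix (Fin n) (Fin n) ℂ} (hA : A.PosDef) (a b : ℝ) :
    cfc (fun x : ℝ => x ^ a) A * cfc (fun x : ℝ => x ^ b) A = cfc (fun x : ℝ => x ^ (a + b)) A := by
  rw [cfc_mm hA]
  exact cfc_ext hA (fun x hx => (Real.rpow_add hx a b).symm)

lemma pow_zz {n : ℕ} {A : Matrix (Fin n) (Fin n) ℂ} (hA : A.PosDef) :
    cfc (fun x : ℝ => x ^ (0 : ℝ)) A = 1 := by
  rw [cfc_ext hA (g := fun _ => 1) (fun x _ => Real.rpow_zero x), cfc_cc hA]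
  simp

lemma W_pd {n : ℕ} {A Y : Matrix (Fin n) (Fin n) ℂ} (hA : A.PosDef) (hY : Y.PosDef) (t : ℝ) :
    (cfc (fun x : ℝ => x ^ t) A * Y * cfc (fun x : ℝ => x ^ t) A).PosDef :=
  conj_pd hY (cfc_hh A _) (D := cfc (fun x : ℝ => x ^ (-t)) A)
    (by rw [pow_mm hA, add_neg_cancel, pow_zz hA])

lemma W_inv {n : ℕ} {A Y : Matrix (Fin n) (Fin n) ℂ} (hA : A.PosDef) (hY : Y.PosDef) (t : ℝ) :
    cfc (fun x : ℝ => x⁻¹) (cfc (fun x : ℝ => x ^ t) A * Y * cfc (fun x : ℝ => x ^ t) A)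
     = cfc (fun x : ℝ => x ^ (-t)) A * cfc (fun x : ℝ => x⁻¹) Y * cfc (fun x : ℝ => x ^ (-t)) A := by
  have hi : ∀ {M : Matrix (Fin n) (Fin n) ℂ}, M.PosDef → cfc (fun x : ℝ => x⁻¹) M = M⁻¹ := by
    intro M hM
    symm
    apply Matrix.inv_eq_left_inv
    calc _ = cfc (fun x : ℝ => x⁻¹) M * cfc (fun x : ℝ => x) M := by rw [cfc_ii hM]
      _ = _ := by
        rw [cfc_mm hM, cfc_ext hM (g := fun _ => 1) (fun x hx => inv_mul_cancel₀ hx.ne'), cfc_cc hM]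
        simp
  have hc : (cfc (fun x : ℝ => x ^ t) A)⁻¹ = cfc (fun x : ℝ => x ^ (-t)) A := by
    apply Matrix.inv_eq_left_inv
    rw [pow_mm hA, neg_add_cancel, pow_zz hA]
  rw [hi (W_pd hA hY t), hi hY, Matrix.mul_inv_rev, Matrix.mul_inv_rev, hc, Matrix.mul_assoc]

lemma main {n : ℕ} {A Y : Matrix (Fin n) (Fin n) ℂ} (hA : A.PosDef) (hY : Y.PosDef)
    {p : ℝ} (hp : 0 < p) :
    (trace (A * cfc Real.log Y)).re + p * (trace (A * cfc Real.log A)).re ≤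
    (trace (A * cfc Real.log
      (cfc (fun x : ℝ => x ^ (p / 2)) A * Y * cfc (fun x : ℝ => x ^ (p / 2)) A))).re := by
  obtain ⟨L, hL, hLA⟩ := psd_log hA
  obtain ⟨w, hw0, hw⟩ := bdd hA Y (fun t => t) continuous_id p
  obtain ⟨c, hc0, hc⟩ := bdd hA (cfc (fun x : ℝ => x⁻¹) Y) (fun t => 1 - t) (by fun_prop) p
  have hsub := subdiv (fun t => (trace (A * cfc Real.log
      (cfc (fun x : ℝ => x ^ (t / 2)) A * Y * cfc (fun x : ℝ => x ^ (t / 2)) A))).re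
      - t * (trace (A * cfc Real.log A)).re) (L ^ 2 / 2 * (trace A).re + w * L ^ 2 * c) (2 / L) p
      (by positivity) hp ?_
  · simp only [zero_div, pow_zz hA, Matrix.one_mul, Matrix.mul_one, zero_mul, sub_zero] at hsub
    linarith
  intro x y hx hxy hy hε
  have hy0 : 0 ≤ y := hx.trans hxy
  obtain ⟨ε, rfl⟩ : ∃ ε, y = x + ε := ⟨y - x, by ring⟩
  have hε0 : 0 ≤ ε := by linarith
  have hεL : ε * L ≤ 2 := by
    rw [add_sub_cancel_left, le_div_iff₀ hL] at hε
    exact hε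
  rw [add_sub_cancel_left]
  have hv : ∀ u : ℝ, 0 < u → u ^ (-(ε / 2)) = Real.exp (-(ε * Real.log u / 2)) := by
    intro u hu
    rw [Real.rpow_def_of_pos hu]
    congr 1
    ring
  have hvb : ∀ u : ℝ, |Real.log u| ≤ L → |-(ε * Real.log u / 2)| ≤ ε * L / 2 := by
    intro u hu
    rw [abs_neg, abs_div, abs_mul, abs_of_nonneg hε0, abs_two]
    gcongr
  have hDD : (1 : Matrix (Fin n) (Fin n) ℂ) - cfc (fun u : ℝ => 1 - u ^ (-(ε / 2))) A
      = cfc (fun u : ℝ => u ^ (-(ε / 2))) A := by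
    rw [← cfc_ss hA, cfc_cc hA]
    simp
  have hcore := core hA (W_pd hA hY ((x + ε) / 2)) (W_pd hA hY (x / 2))
    (fun u => 1 - u ^ (-(ε / 2))) rfl ?_ ?_ (w := w) (δ := ε ^ 2 * L ^ 2) hw0 ?_ ?_
  · have h1 : (trace (A * cfc (fun x : ℝ => x⁻¹) (cfc (fun u : ℝ => u ^ ((x + ε) / 2)) A * Y
        * cfc (fun u : ℝ => u ^ ((x + ε) / 2)) A))).re ≤ c := by
      rw [W_inv hA hY]
      refine le_trans (le_of_eq ?_) (hc (x + ε) hy0 hy)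
      congr 1
      have : cfc (fun u : ℝ => u ^ (1 - (x + ε))) A
          = cfc (fun u : ℝ => u ^ (-((x + ε) / 2))) A * A * cfc (fun u : ℝ => u ^ (-((x + ε) / 2))) A := by
        have e : A = cfc (fun u : ℝ => u ^ (1 : ℝ)) A := by
          simp only [Real.rpow_one]
          exact (cfc_ii hA).symm
        calc _ = cfc (fun u : ℝ => u ^ (-((x + ε) / 2))) A * cfc (fun u : ℝ => u ^ (1 : ℝ)) A
              * cfc (fun u : ℝ => u ^ (-((x + ε) / 2))) A := by
              rw [pow_mm hA, pow_mm hA]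
              congr 1
              funext u
              congr 1
              ring
          _ = _ := by rw [← e]
      rw [this, Matrix.trace_mul_comm, Matrix.mul_assoc, Matrix.mul_assoc, Matrix.trace_mul_comm]
      simp only [Matrix.mul_assoc]
    have h2 : 0 ≤ (trace (A * (cfc (fun u : ℝ => 2 * (1 - u ^ (-(ε / 2))) - ε * Real.log u
        + L ^ 2 / 2 * ε ^ 2) A))).re := by
      refine tr_nonneg hA (hLA _ (fun u hu hul => ?_))
      rw [hv u hu]
      have b := hvb u hul
      have b1 : |-(ε * Real.log u / 2)| ≤ 1 := by linarith
      have b2 := (abs_le.1 (Real.abs_exp_sub_one_sub_id_le b1)).2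
      have b3 : (-(ε * Real.log u / 2)) ^ 2 ≤ (ε * L / 2) ^ 2 := sq_le_sq' (by
        linarith [(abs_le.1 b).1]) (abs_le.1 b).2
      nlinarith
    obtain ⟨l, hl, hl'⟩ := tr_rep hA
    obtain ⟨α, hα⟩ := hl' A
    have c1 := hα (fun _ => 1)
    rw [cfc_cc hA] at c1
    simp only [Complex.ofReal_one, one_smul, mul_one] at c1
    rw [hα] at h2 hcore ⊢
    have h3 : ∑ i, α i * (2 * (1 - l i ^ (-(ε / 2))) - ε * Real.log (l i) + L ^ 2 / 2 * ε ^ 2)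
        = 2 * ∑ i, α i * (1 - l i ^ (-(ε / 2))) - ε * ∑ i, α i * Real.log (l i)
          + L ^ 2 / 2 * ε ^ 2 * (trace A).re := by
      rw [c1, Finset.mul_sum, Finset.mul_sum, Finset.mul_sum, ← Finset.sum_sub_distrib,
        ← Finset.sum_add_distrib]
      exact Finset.sum_congr rfl (fun i _ => by ring)
    rw [h3] at h2
    have h4 := mul_le_mul_of_nonneg_left h1 (show 0 ≤ w * (ε ^ 2 * L ^ 2) by positivity)
    linarith
  · intro a b ha hb
    rcases le_total a b with h | h
    · have := Real.rpow_le_rpow_of_nonpos ha h (show -(ε / 2) ≤ 0 by linarith)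
      nlinarith
    · have := Real.rpow_le_rpow_of_nonpos hb h (show -(ε / 2) ≤ 0 by linarith)
      nlinarith
  · rw [hDD]
    have e1 : cfc (fun u : ℝ => u ^ (x / 2)) A
        = cfc (fun u : ℝ => u ^ (-(ε / 2))) A * cfc (fun u : ℝ => u ^ ((x + ε) / 2)) A := by
      rw [pow_mm hA, show -(ε / 2) + (x + ε) / 2 = x / 2 by ring]
    have e2 : cfc (fun u : ℝ => u ^ (x / 2)) A
        = cfc (fun u : ℝ => u ^ ((x + ε) / 2)) A * cfc (fun u : ℝ => u ^ (-(ε / 2))) A := by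
      rw [pow_mm hA, show (x + ε) / 2 + -(ε / 2) = x / 2 by ring]
    calc _ = (cfc (fun u : ℝ => u ^ (-(ε / 2))) A * cfc (fun u : ℝ => u ^ ((x + ε) / 2)) A) * Y
          * (cfc (fun u : ℝ => u ^ ((x + ε) / 2)) A * cfc (fun u : ℝ => u ^ (-(ε / 2))) A) := by
          rw [← e1, ← e2]
      _ = _ := by simp only [Matrix.mul_assoc]
  · apply psd_tr (W_pd hA hY _)
    refine le_trans (le_of_eq ?_) (hw (x + ε) hy0 hy)
    rw [Matrix.mul_assoc, Matrix.trace_mul_comm, Matrix.mul_assoc, pow_mm hA, add_halves]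
  · have : (((ε ^ 2 * L ^ 2 : ℝ)) : ℂ) • (1 : Matrix (Fin n) (Fin n) ℂ)
        - cfc (fun u : ℝ => 1 - u ^ (-(ε / 2))) A * cfc (fun u : ℝ => 1 - u ^ (-(ε / 2))) A
        = cfc (fun u : ℝ => ε ^ 2 * L ^ 2 - (1 - u ^ (-(ε / 2))) * (1 - u ^ (-(ε / 2)))) A := by
      rw [cfc_mm hA, ← cfc_cc hA, cfc_ss hA]
    rw [this]
    refine hLA _ (fun u hu hul => ?_)
    rw [hv u hu]
    have b := hvb u hul
    have b1 : |-(ε * Real.log u / 2)| ≤ 1 := by linarith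
    have b2 := Real.abs_exp_sub_one_le b1
    have b4 : |Real.exp (-(ε * Real.log u / 2)) - 1| ≤ ε * L := by linarith
    have b3 : (Real.exp (-(ε * Real.log u / 2)) - 1) ^ 2 ≤ (ε * L) ^ 2 :=
      sq_le_sq' (abs_le.1 b4).1 (abs_le.1 b4).2
    nlinarith

lemma log_pow {n : ℕ} {B : Matrix (Fin n) (Fin n) ℂ} (hB : B.PosDef) (p : ℝ) :
    cfc Real.log (cfc (fun x : ℝ => x ^ p) B) = (p : ℂ) • cfc Real.log B := by
  have hfin : (spectrum ℝ B).Finite := by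
    rw [hB.1.spectrum_real_eq_range_eigenvalues]
    exact Set.finite_range _
  rw [← cfc_comp' Real.log (fun x : ℝ => x ^ p) B ((hfin.image _).continuousOn _)
    (hfin.continuousOn _) hB.1.isSelfAdjoint,
    cfc_ext hB (g := fun x => p * Real.log x) (fun x hx => Real.log_rpow hx p), ← cfc_mm hB,
    cfc_cc hB, smul_mul_assoc, Matrix.one_mul]

end HP

/-- Hiai–Petz logarithmic trace inequality: for `A, B` positive definite and `p > 0`:
`Tr[A (log A + log B)] ≤ (1/p) Tr[A log(A^{p/2} B^p A^{p/2})]` (as real parts). -/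
theorem stmt_17 {n : ℕ} (A B : Matrix (Fin n) (Fin n) ℂ)
    (hA : A.PosDef) (hB : B.PosDef) (p : ℝ) (hp : 0 < p) :
    (Matrix.trace (A * (mlog A + mlog B))).re ≤
      (1/p) * (Matrix.trace (A * mlog (mpow A (p/2) * mpow B p * mpow A (p/2)))).re := by
  have hY : (cfc (fun x : ℝ => x ^ p) B).PosDef := HP.cfc_pd hB (fun x hx => Real.rpow_pos_of_pos hx p)
  have h := HP.main hA hY hp
  rw [HP.log_pow hB, Matrix.mul_smul, Matrix.trace_smul, smul_eq_mul, Complex.re_ofReal_mul] at h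
  unfold mlog mfun mpow
  rw [Matrix.mul_add, Matrix.trace_add, Complex.add_re, one_div, ← div_eq_inv_mul, le_div_iff₀ hp]
  linarith
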